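/- Let κ = 1/(2(k+1)), g = 1_Ω, and H = 1_Λ. For every 1 ≤ q < ∞ there exist a constant c₀ = c₀(n, k, q) > 0 and R₀ ≥ 1 such that for all R ≥ R₀, ( ∫_{B^{n+1}(0,R)} |Eg(x)|^q H(x) dx )^{1/q} ≥ c₀ · R^{((n+k)/2)(1/q − 1/2) + k/(2(k+1))} · ‖g‖_{L²}. -/

import Mathlib

open MeasureTheory Metric

/-- The Fourier extension operator over the truncated paraboloid: for `f` supported in
`B^d(0,1) ⊂ ℝ^d`, `Ef(x) = ∫_{B^d(0,1)} e^{i(x'·ξ + x_{d+1}|ξ|²)} f(ξ) dξ`. -/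
noncomputable def extOp (d : ℕ) (f : EuclideanSpace ℝ (Fin d) → ℂ)
    (x : EuclideanSpace ℝ (Fin (d + 1))) : ℂ :=
  ∫ ξ in ball (0 : EuclideanSpace ℝ (Fin d)) 1,
    Complex.exp (Complex.I *
      (((∑ i, x i.castSucc * ξ i) + x (Fin.last d) * ‖ξ‖ ^ 2 : ℝ) : ℂ)) * f ξ

/-- The set `Ω := [B^{n+1-k}(0, cR^{-1/2}) × (2πR^{-κ}ℤ^{k-1} + B^{k-1}(0, cR^{-1}))] ∩ B^n(0,1)`
in `ℝ^n`, with `c = 1/1000`, coordinates split as `ξ = (ξ', ξ'') ∈ ℝ^{n+1-k} × ℝ^{k-1}`. -/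
noncomputable def Omega (n k : ℕ) (κ R : ℝ) : Set (EuclideanSpace ℝ (Fin n)) :=
  {ξ : EuclideanSpace ℝ (Fin n) |
      (∑ i : Fin n, if (i : ℕ) < n + 1 - k then ξ i ^ 2 else 0)
          < ((1 / 1000 : ℝ) * R ^ (-(1 : ℝ) / 2)) ^ 2 ∧
      ∃ b : Fin n → ℤ, (∀ i : Fin n, (i : ℕ) < n + 1 - k → b i = 0) ∧
        (∑ i : Fin n, if n + 1 - k ≤ (i : ℕ)
            then (ξ i - 2 * Real.pi * R ^ (-κ) * b i) ^ 2 else 0)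
          < ((1 / 1000 : ℝ) * R⁻¹) ^ 2} ∩
    ball (0 : EuclideanSpace ℝ (Fin n)) 1

/-- The set
`Λ := [B^{n+1-k}(0, cR^{1/2}) × (R^κ ℤ^{k-1} + B^{k-1}(0,c)) × ((1/(2π))R^{2κ}ℤ + (-c,c))] ∩ B^{n+1}(0,R)`
in `ℝ^{n+1}`, with `c = 1/1000`, coordinates split as
`x = (x', x'', x_{n+1}) ∈ ℝ^{n+1-k} × ℝ^{k-1} × ℝ`. -/
noncomputable def Lambda (n k : ℕ) (κ R : ℝ) : Set (EuclideanSpace ℝ (Fin (n + 1))) :=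
  {x : EuclideanSpace ℝ (Fin (n + 1)) |
      (∑ i : Fin (n + 1), if (i : ℕ) < n + 1 - k then x i ^ 2 else 0)
          < ((1 / 1000 : ℝ) * R ^ ((1 : ℝ) / 2)) ^ 2 ∧
      (∃ a : Fin (n + 1) → ℤ,
        (∀ i : Fin (n + 1), ¬(n + 1 - k ≤ (i : ℕ) ∧ (i : ℕ) < n) → a i = 0) ∧
        (∑ i : Fin (n + 1), if n + 1 - k ≤ (i : ℕ) ∧ (i : ℕ) < n
            then (x i - R ^ κ * a i) ^ 2 else 0)
          < ((1 / 1000 : ℝ)) ^ 2) ∧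
      (∃ j : ℤ, |x (Fin.last n) - 1 / (2 * Real.pi) * R ^ (2 * κ) * j| < (1 / 1000 : ℝ))} ∩
    ball (0 : EuclideanSpace ℝ (Fin (n + 1))) R

lemma sum_ite_sq_lt {d : ℕ} (p : Fin d → Prop) [DecidablePred p] (y : Fin d → ℝ) {ρ : ℝ}
    (hρ : 0 < ρ) (h : ∀ i, p i → |y i| ≤ ρ / (d + 1)) :
    (∑ i, if p i then y i ^ 2 else 0) < ρ ^ 2 := by
  have hd : (0 : ℝ) ≤ d := d.cast_nonneg
  calc (∑ i, if p i then y i ^ 2 else 0) ≤ ∑ _i : Fin d, (ρ / (d + 1)) ^ 2 := by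
        refine Finset.sum_le_sum fun i _ => ?_
        split_ifs with hi
        · exact sq_le_sq' (abs_le.1 (h i hi)).1 (abs_le.1 (h i hi)).2
        · positivity
    _ = ρ ^ 2 * (d / (d + 1) ^ 2) := by
          simp only [Finset.sum_const, Finset.card_univ, Fintype.card_fin, nsmul_eq_mul]
          field_simp
    _ < ρ ^ 2 * 1 := by
        refine mul_lt_mul_of_pos_left ?_ (by positivity)
        rw [div_lt_one (by positivity)]
        nlinarith
    _ = ρ ^ 2 := mul_one _

lemma sum_ite_val_lt {m n : ℕ} (hmn : m ≤ n) (a b : ℝ) :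
    (∑ i : Fin n, if (i : ℕ) < m then a else b) = m * a + ((n : ℝ) - m) * b := by
  obtain ⟨j, rfl⟩ := Nat.exists_eq_add_of_le hmn
  simp [Fin.sum_univ_add]

lemma ofReal_le_volume_lattice_nhds {s r L : ℝ} (hr : 0 < r) (hrs : 2 * r ≤ s) (hsL : s ≤ L) :
    ENNReal.ofReal (L * r / s) ≤ volume {t : ℝ | |t| < L ∧ ∃ b : ℤ, |t - s * b| < r} := by
  have hs : 0 < s := by linarith
  set N := ⌊L / s⌋₊ with hN
  have h1 : 1 ≤ L / s := by rwa [le_div_iff₀ hs, one_mul]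
  have hN1 : 1 ≤ N := Nat.le_floor (by simpa using h1)
  have hN1' : (1 : ℝ) ≤ N := by exact_mod_cast hN1
  have hNle : s * N ≤ L := by
    have := Nat.floor_le (zero_le_one.trans h1)
    rw [← hN, le_div_iff₀ hs] at this
    linarith
  have hNlt : L / s < N + 1 := Nat.lt_floor_add_one _
  have hsub : (⋃ b ∈ Finset.range N, ball (s * (b : ℝ)) r) ⊆
      {t : ℝ | |t| < L ∧ ∃ b : ℤ, |t - s * b| < r} := by
    intro t ht
    simp only [Set.mem_iUnion, Finset.mem_range, mem_ball, Real.dist_eq, exists_prop] at ht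
    obtain ⟨b, hb, ht⟩ := ht
    refine ⟨?_, b, by simpa using ht⟩
    have hb' : (b : ℝ) + 1 ≤ N := by exact_mod_cast hb
    have hb0 : 0 ≤ s * (b : ℝ) := by positivity
    have := mul_le_mul_of_nonneg_left hb' hs.le
    rw [abs_lt] at ht ⊢
    constructor <;> linarith
  have hdisj : Set.PairwiseDisjoint (↑(Finset.range N)) fun b : ℕ => ball (s * (b : ℝ)) r := by
    intro b _ b' _ hbb
    refine ball_disjoint_ball ?_
    have : (1 : ℝ) ≤ |(b : ℝ) - b'| := by
      have h : (1 : ℤ) ≤ |(b : ℤ) - b'| := Int.one_le_abs (by omega)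
      exact_mod_cast h
    rw [Real.dist_eq, ← mul_sub, abs_mul, abs_of_pos hs]
    nlinarith
  refine le_trans ?_ (measure_mono hsub)
  rw [measure_biUnion_finset hdisj fun _ _ => measurableSet_ball]
  simp only [Real.volume_ball, Finset.sum_const, Finset.card_range, nsmul_eq_mul]
  rw [← ENNReal.ofReal_natCast, ← ENNReal.ofReal_mul (Nat.cast_nonneg _)]
  refine ENNReal.ofReal_le_ofReal ?_
  rw [mul_div_right_comm]
  nlinarith

lemma ofReal_prod_le_volume {d : ℕ} {S : Set (EuclideanSpace ℝ (Fin d))} (T : Fin d → Set ℝ)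
    (v : Fin d → ℝ) (hv : ∀ i, 0 ≤ v i) (hT : ∀ i, ENNReal.ofReal (v i) ≤ volume (T i))
    (hS : ∀ x : EuclideanSpace ℝ (Fin d), (∀ i, x i ∈ T i) → x ∈ S) :
    ENNReal.ofReal (∏ i, v i) ≤ volume S := by
  have hpre : MeasurableEquiv.toLp 2 (Fin d → ℝ) ⁻¹' S ⊇ Set.univ.pi T := fun x hx =>
    hS _ fun i => hx i trivial
  have hvol := (EuclideanSpace.volume_preserving_symm_measurableEquiv_toLp (Fin d)).symm
    |>.measure_preimage_equiv S
  rw [← hvol, ENNReal.ofReal_prod_of_nonneg fun i _ => hv i]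
  refine le_trans ?_ (measure_mono hpre)
  rw [volume_pi_pi]
  exact Finset.prod_le_prod' fun i _ => hT i

lemma abs_sum_mul_le {ι : Type*} (s : Finset ι) (f g : ι → ℝ) {A B : ℝ} (hA : 0 ≤ A)
    (hB : 0 ≤ B) (hf : ∑ i ∈ s, f i ^ 2 ≤ A ^ 2) (hg : ∑ i ∈ s, g i ^ 2 ≤ B ^ 2) :
    |∑ i ∈ s, f i * g i| ≤ A * B := by
  refine abs_le_of_sq_le_sq ?_ (mul_nonneg hA hB)
  calc (∑ i ∈ s, f i * g i) ^ 2 ≤ (∑ i ∈ s, f i ^ 2) * ∑ i ∈ s, g i ^ 2 :=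
        Finset.sum_mul_sq_le_sq_mul_sq s f g
    _ ≤ A ^ 2 * B ^ 2 := mul_le_mul hf hg (Finset.sum_nonneg fun _ _ => sq_nonneg _) (sq_nonneg _)
    _ = (A * B) ^ 2 := by ring

lemma isOpen_Omega (n k : ℕ) (κ R : ℝ) : IsOpen (Omega n k κ R) := by
  refine IsOpen.inter (IsOpen.and ?_ ?_) isOpen_ball
  · refine isOpen_lt (continuous_finsetSum _ fun i _ => ?_) continuous_const
    split_ifs <;> fun_prop
  · rw [Set.ofPred_exists]
    refine isOpen_iUnion fun b => isOpen_const.and ?_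
    refine isOpen_lt (continuous_finsetSum _ fun i _ => ?_) continuous_const
    split_ifs <;> fun_prop

lemma isOpen_Lambda (n k : ℕ) (κ R : ℝ) : IsOpen (Lambda n k κ R) := by
  refine IsOpen.inter (IsOpen.and ?_ (IsOpen.and ?_ ?_)) isOpen_ball
  · refine isOpen_lt (continuous_finsetSum _ fun i _ => ?_) continuous_const
    split_ifs <;> fun_prop
  · rw [Set.ofPred_exists]
    refine isOpen_iUnion fun b => isOpen_const.and ?_
    refine isOpen_lt (continuous_finsetSum _ fun i _ => ?_) continuous_const
    split_ifs <;> fun_prop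
  · rw [Set.ofPred_exists]
    refine isOpen_iUnion fun j => isOpen_lt ?_ continuous_const
    fun_prop

/-- On the product of the two lattice neighbourhoods the phase of the extension operator is
within `1/10` of an integer multiple of `2π`. -/
lemma exists_int_abs_phase_sub_le {n k : ℕ} {κ R : ℝ} (hk : k ≤ n + 1) (hk1 : 1 ≤ k)
    (hR : 1 ≤ R) {ξ : EuclideanSpace ℝ (Fin n)} (hξ : ξ ∈ Omega n k κ R)
    {x : EuclideanSpace ℝ (Fin (n + 1))} (hx : x ∈ Lambda n k κ R) :
    ∃ N : ℤ, |(∑ i, x i.castSucc * ξ i) + x (Fin.last n) * ‖ξ‖ ^ 2 - N * (2 * Real.pi)|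
      ≤ 1 / 10 := by
  have hR0 : 0 < R := by linarith
  obtain ⟨⟨hξ1, b, hb, hξ2⟩, hξ3⟩ := hξ
  obtain ⟨⟨hx1, ⟨a, ha, hx2⟩, j, hx3⟩, hx4⟩ := hx
  generalize hm : n + 1 - k = m at *
  have hmn : m ≤ n := by omega
  rw [mem_ball_zero_iff] at hξ3 hx4
  have hξ3' : ∑ i, ξ i ^ 2 ≤ 1 ^ 2 := by
    rw [← EuclideanSpace.real_norm_sq_eq]
    exact pow_le_pow_left₀ (norm_nonneg _) hξ3.le 2
  have hx4' : ∑ i, x i ^ 2 ≤ R ^ 2 := by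
    rw [← EuclideanSpace.real_norm_sq_eq]
    exact pow_le_pow_left₀ (norm_nonneg _) hx4.le 2
  rw [Fin.sum_univ_castSucc] at hx1 hx2 hx4'
  simp only [Fin.val_castSucc, Fin.val_last, lt_irrefl, and_false, if_false, add_zero, Fin.is_lt,
    and_true, not_lt.2 hmn] at hx1 hx2
  have ha' : ∀ i : Fin n, (i : ℕ) < m → a i.castSucc = 0 := fun i hi => ha _ (by simp; omega)
  rw [EuclideanSpace.real_norm_sq_eq]
  set t := x (Fin.last n) with ht
  have htR : |t| ≤ R := by
    refine abs_le_of_sq_le_sq ?_ hR0.le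
    have : 0 ≤ ∑ i : Fin n, x i.castSucc ^ 2 := Finset.sum_nonneg fun _ _ => sq_nonneg _
    linarith
  have hxR : ∑ i : Fin n, x i.castSucc ^ 2 ≤ R ^ 2 := by
    have := sq_nonneg t
    linarith
  set y : Fin n → ℝ := fun i => x i.castSucc with hy
  have hya : ∀ i : Fin n, x i.castSucc = y i := fun _ => rfl
  simp only [hya] at *
  set s := Finset.univ.filter fun i : Fin n => (i : ℕ) < m with hs
  set s' := Finset.univ.filter fun i : Fin n => m ≤ (i : ℕ) with hs'
  have hsum : ∀ f : Fin n → ℝ, ∑ i, f i = ∑ i ∈ s, f i + ∑ i ∈ s', f i := by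
    intro f
    rw [← Finset.sum_filter_add_sum_filter_not Finset.univ (fun i : Fin n => (i : ℕ) < m)]
    simp only [not_lt, hs, hs']
  rw [← Finset.sum_filter] at hξ1 hξ2 hx1 hx2
  have hsub : ∀ (f : Fin n → ℝ), ∑ i ∈ s', f i ^ 2 ≤ ∑ i, f i ^ 2 := fun f =>
    Finset.sum_le_sum_of_subset_of_nonneg (Finset.subset_univ _) fun _ _ _ => sq_nonneg _
  have hy' := (hsub y).trans hxR
  have hξ' := (hsub ξ).trans hξ3'
  set β : Fin n → ℝ := fun i => 2 * Real.pi * R ^ (-κ) * b i with hβ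
  set u : Fin n → ℝ := fun i => y i - R ^ κ * a i.castSucc with hu
  set v : Fin n → ℝ := fun i => ξ i - β i with hv
  have hRinv : R⁻¹ ≤ 1 := inv_le_one_of_one_le₀ hR
  have hRi0 : 0 < R⁻¹ := by positivity
  have hhalf : R ^ ((1 : ℝ) / 2) * R ^ (-(1 : ℝ) / 2) = 1 := by
    rw [← Real.rpow_add hR0]; norm_num
  have hhalf2 : (R ^ (-(1 : ℝ) / 2)) ^ 2 = R⁻¹ := by
    rw [← Real.rpow_natCast, ← Real.rpow_mul hR0.le, ← Real.rpow_neg_one]; norm_num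
  have hκ : R ^ κ * R ^ (-κ) = 1 := by rw [← Real.rpow_add hR0]; simp
  have hκ2 : R ^ (2 * κ) * (R ^ (-κ)) ^ 2 = 1 := by
    rw [← Real.rpow_natCast, ← Real.rpow_mul hR0.le, ← Real.rpow_add hR0]
    norm_num; ring_nf; simp
  have hβ2 : ∑ i ∈ s', β i ^ 2 ≤ 2 ^ 2 := by
    have h1 : ∀ i, β i ^ 2 ≤ 2 * ξ i ^ 2 + 2 * v i ^ 2 := fun i => by
      simp only [hv]; nlinarith [sq_nonneg (2 * ξ i - β i)]
    have h2 := Finset.sum_le_sum fun i (_ : i ∈ s') => h1 i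
    rw [Finset.sum_add_distrib, ← Finset.mul_sum, ← Finset.mul_sum] at h2
    have h3 : (1 / 1000 * R⁻¹) ^ 2 ≤ 1 := by nlinarith
    linarith
  have hadd2 : ∑ i ∈ s', (ξ i + β i) ^ 2 ≤ 4 ^ 2 := by
    have h1 : ∀ i, (ξ i + β i) ^ 2 ≤ 2 * ξ i ^ 2 + 2 * β i ^ 2 := fun i => by
      nlinarith [sq_nonneg (ξ i - β i)]
    have h2 := Finset.sum_le_sum fun i (_ : i ∈ s') => h1 i
    rw [Finset.sum_add_distrib, ← Finset.mul_sum, ← Finset.mul_sum] at h2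
    linarith
  have e1 : |∑ i ∈ s, y i * ξ i| ≤ 1 / 1000000 := by
    refine (abs_sum_mul_le s y ξ (by positivity) (by positivity) hx1.le hξ1.le).trans ?_
    linear_combination (1 / 1000000 : ℝ) * hhalf
  have e2 : |∑ i ∈ s', y i * v i| ≤ 1 / 1000 := by
    refine (abs_sum_mul_le s' y v hR0.le (by positivity) hy' hξ2.le).trans ?_
    rw [mul_left_comm, mul_inv_cancel₀ hR0.ne', mul_one]
  have e3 : |∑ i ∈ s', u i * β i| ≤ 1 / 1000 * 2 :=
    abs_sum_mul_le s' u β (by positivity) (by positivity) hx2.le hβ2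
  have e4 : |∑ i ∈ s', v i * (ξ i + β i)| ≤ 1 / 1000 * R⁻¹ * 4 :=
    abs_sum_mul_le s' v _ (by positivity) (by positivity) hξ2.le hadd2
  have e5 : |∑ i ∈ s, ξ i ^ 2| ≤ 1 / 1000000 * R⁻¹ := by
    rw [abs_of_nonneg (Finset.sum_nonneg fun _ _ => sq_nonneg _)]
    rw [mul_pow, hhalf2] at hξ1
    linarith
  have e6 : |t * (∑ i ∈ s, ξ i ^ 2 + ∑ i ∈ s', v i * (ξ i + β i))| ≤ 1 / 200 := by
    rw [abs_mul]
    calc _ ≤ R * (1 / 1000000 * R⁻¹ + 1 / 1000 * R⁻¹ * 4) :=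
          mul_le_mul htR ((abs_add_le _ _).trans (add_le_add e5 e4)) (abs_nonneg _) hR0.le
      _ = (1 / 1000000 + 4 / 1000) * (R * R⁻¹) := by ring
      _ ≤ 1 / 200 := by rw [mul_inv_cancel₀ hR0.ne']; norm_num
  set τ := t - 1 / (2 * Real.pi) * R ^ (2 * κ) * j with hτ
  have e7 : |τ * ∑ i ∈ s', β i ^ 2| ≤ 1 / 1000 * 2 ^ 2 := by
    rw [abs_mul, abs_of_nonneg (Finset.sum_nonneg fun i _ => sq_nonneg (β i))]
    exact mul_le_mul hx3.le hβ2 (Finset.sum_nonneg fun _ _ => sq_nonneg _) (by norm_num)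
  refine ⟨∑ i ∈ s', a i.castSucc * b i + j * ∑ i ∈ s', b i ^ 2, ?_⟩
  have key1 : ∑ i ∈ s', y i * ξ i = ∑ i ∈ s', y i * v i + ∑ i ∈ s', u i * β i +
      (∑ i ∈ s', (a i.castSucc : ℝ) * b i) * (2 * Real.pi) := by
    rw [Finset.sum_mul, ← Finset.sum_add_distrib, ← Finset.sum_add_distrib]
    refine Finset.sum_congr rfl fun i _ => ?_
    simp only [hu, hv, hβ]
    linear_combination (2 * Real.pi * (a i.castSucc : ℝ) * b i) * hκ
  have key2 : ∑ i ∈ s', ξ i ^ 2 = ∑ i ∈ s', v i * (ξ i + β i) + ∑ i ∈ s', β i ^ 2 := by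
    rw [← Finset.sum_add_distrib]
    refine Finset.sum_congr rfl fun i _ => ?_
    simp only [hv]; ring
  have key3 : 1 / (2 * Real.pi) * R ^ (2 * κ) * j * ∑ i ∈ s', β i ^ 2 =
      (j * ∑ i ∈ s', (b i : ℝ) ^ 2) * (2 * Real.pi) := by
    simp only [hβ, mul_pow]
    rw [← Finset.mul_sum]
    have hpi := Real.pi_ne_zero
    field_simp
    linear_combination ((j : ℝ) * ∑ i ∈ s', (b i : ℝ) ^ 2) * hκ2
  have key : (∑ i, y i * ξ i) + t * ∑ i, ξ i ^ 2 -
      ((∑ i ∈ s', a i.castSucc * b i + j * ∑ i ∈ s', b i ^ 2 : ℤ) : ℝ) * (2 * Real.pi) =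
      ∑ i ∈ s, y i * ξ i + ∑ i ∈ s', y i * v i + ∑ i ∈ s', u i * β i +
      t * (∑ i ∈ s, ξ i ^ 2 + ∑ i ∈ s', v i * (ξ i + β i)) + τ * ∑ i ∈ s', β i ^ 2 := by
    push_cast
    rw [hsum, hsum fun i => ξ i ^ 2, key1, key2, hτ]
    linear_combination key3
  rw [key]
  rw [abs_le] at *
  constructor <;> linarith

lemma half_volume_le_norm_extOp {n k : ℕ} {κ R : ℝ} (hk : k ≤ n + 1) (hk1 : 1 ≤ k)
    (hR : 1 ≤ R) {x : EuclideanSpace ℝ (Fin (n + 1))} (hx : x ∈ Lambda n k κ R) :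
    volume.real (Omega n k κ R) / 2
      ≤ ‖extOp n ((Omega n k κ R).indicator (fun _ => (1 : ℂ))) x‖ := by
  set Ω := Omega n k κ R with hΩ
  set φ : EuclideanSpace ℝ (Fin n) → ℝ := fun ξ =>
    (∑ i, x i.castSucc * ξ i) + x (Fin.last n) * ‖ξ‖ ^ 2 with hφ
  have hmeas : MeasurableSet Ω := (isOpen_Omega n k κ R).measurableSet
  have hsub : Ω ⊆ ball 0 1 := Set.inter_subset_right
  have hfin : volume Ω ≠ ⊤ := measure_ne_top_of_subset hsub measure_ball_lt_top.ne
  have hφc : Continuous φ := by fun_prop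
  have hext : extOp n (Ω.indicator fun _ => (1 : ℂ)) x =
      ∫ ξ in Ω, Complex.exp (Complex.I * (φ ξ : ℂ)) := by
    rw [extOp]
    have : ∀ ξ, Complex.exp (Complex.I * (((∑ i, x i.castSucc * ξ i) +
        x (Fin.last n) * ‖ξ‖ ^ 2 : ℝ) : ℂ)) * Ω.indicator (fun _ => (1 : ℂ)) ξ =
        Ω.indicator (fun ξ => Complex.exp (Complex.I * (φ ξ : ℂ))) ξ := by
      intro ξ
      by_cases h : ξ ∈ Ω <;> simp [h, hφ]
    simp_rw [this]
    rw [setIntegral_indicator hmeas, Set.inter_eq_right.2 hsub]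
  have hint : IntegrableOn (fun ξ => Complex.exp (Complex.I * (φ ξ : ℂ))) Ω := by
    refine Measure.integrableOn_of_bounded (M := 1) hfin ?_ ?_
    · exact Continuous.aestronglyMeasurable (by fun_prop)
    · filter_upwards with ξ
      rw [mul_comm, Complex.norm_exp_ofReal_mul_I]
  rw [hext]
  refine le_trans ?_ (Complex.re_le_norm _)
  have hre : (∫ ξ in Ω, Complex.exp (Complex.I * (φ ξ : ℂ))).re =
      ∫ ξ in Ω, Real.cos (φ ξ) := by
    have h := integral_re (μ := volume.restrict Ω) hint
    simp only [RCLike.re_to_complex] at h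
    rw [← h]
    refine integral_congr_ae (Filter.Eventually.of_forall fun ξ => ?_)
    simp only [mul_comm Complex.I, Complex.exp_ofReal_mul_I_re]
  rw [hre]
  calc volume.real Ω / 2 = ∫ _ξ in Ω, (1 / 2 : ℝ) := by
        rw [setIntegral_const, smul_eq_mul]; ring
    _ ≤ ∫ ξ in Ω, Real.cos (φ ξ) := by
        refine setIntegral_mono_on (integrableOn_const hfin) ?_ hmeas fun ξ hξ => ?_
        · refine Measure.integrableOn_of_bounded (M := 1) hfin ?_ ?_
          · exact Continuous.aestronglyMeasurable (by fun_prop)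
          · filter_upwards with ξ
            exact Real.abs_cos_le_one _
        · obtain ⟨N, hN⟩ := exists_int_abs_phase_sub_le hk hk1 hR hξ hx
          rw [← Real.cos_sub_int_mul_two_pi _ N]
          have h := Real.one_sub_sq_div_two_le_cos (x := φ ξ - N * (2 * Real.pi))
          have h2 := sq_le_sq' (abs_le.1 hN).1 (abs_le.1 hN).2
          simp only [hφ] at h ⊢
          linarith

lemma stronglyMeasurable_extOp {d : ℕ} {f : EuclideanSpace ℝ (Fin d) → ℂ} (hf : Measurable f) :
    StronglyMeasurable (extOp d f) := by
  have hF : StronglyMeasurable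
      fun p : EuclideanSpace ℝ (Fin (d + 1)) × EuclideanSpace ℝ (Fin d) =>
        Complex.exp (Complex.I *
          (((∑ i, p.1 i.castSucc * p.2 i) + p.1 (Fin.last d) * ‖p.2‖ ^ 2 : ℝ) : ℂ)) * f p.2 := by
    refine StronglyMeasurable.mul (Continuous.stronglyMeasurable (by fun_prop))
      (hf.comp measurable_snd).stronglyMeasurable
  exact hF.integral_prod_right' (ν := volume.restrict (ball 0 1))

lemma norm_extOp_le {d : ℕ} {f : EuclideanSpace ℝ (Fin d) → ℂ} (hf : ∀ ξ, ‖f ξ‖ ≤ 1)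
    (x : EuclideanSpace ℝ (Fin (d + 1))) :
    ‖extOp d f x‖ ≤ volume.real (ball (0 : EuclideanSpace ℝ (Fin d)) 1) := by
  refine (norm_setIntegral_le_of_norm_le_const (C := 1) measure_ball_lt_top fun ξ _ => ?_).trans
    (one_mul _).le
  rw [norm_mul, mul_comm Complex.I, Complex.norm_exp_ofReal_mul_I, one_mul]
  exact hf ξ

lemma half_volume_rpow_mul_le_integral {n k : ℕ} {κ R q : ℝ} (hk : k ≤ n + 1) (hk1 : 1 ≤ k)
    (hR : 1 ≤ R) (hq : 0 ≤ q) :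
    (volume.real (Omega n k κ R) / 2) ^ q * volume.real (Lambda n k κ R) ≤
      ∫ x in ball (0 : EuclideanSpace ℝ (Fin (n + 1))) R,
        ‖extOp n ((Omega n k κ R).indicator (fun _ => (1 : ℂ))) x‖ ^ q *
          (Lambda n k κ R).indicator (fun _ => (1 : ℝ)) x := by
  set Ω := Omega n k κ R with hΩ
  set Λ := Lambda n k κ R with hΛ
  have hmeas : MeasurableSet Ω := (isOpen_Omega n k κ R).measurableSet
  have hmeasΛ : MeasurableSet Λ := (isOpen_Lambda n k κ R).measurableSet
  have hsub : Λ ⊆ ball 0 R := Set.inter_subset_right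
  have hfin : volume Λ ≠ ⊤ := measure_ne_top_of_subset hsub measure_ball_lt_top.ne
  have hind : ∀ ξ, ‖Ω.indicator (fun _ => (1 : ℂ)) ξ‖ ≤ 1 := fun ξ => by
    by_cases h : ξ ∈ Ω <;> simp [h]
  have : ∀ x, ‖extOp n (Ω.indicator (fun _ => (1 : ℂ))) x‖ ^ q *
      Λ.indicator (fun _ => (1 : ℝ)) x =
      Λ.indicator (fun x => ‖extOp n (Ω.indicator (fun _ => (1 : ℂ))) x‖ ^ q) x := by
    intro x
    by_cases h : x ∈ Λ <;> simp [h]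
  simp_rw [this]
  rw [setIntegral_indicator hmeasΛ, Set.inter_eq_right.2 hsub]
  calc _ = ∫ _x in Λ, (volume.real Ω / 2) ^ q := by
        rw [setIntegral_const, smul_eq_mul, mul_comm]
    _ ≤ _ := by
        refine setIntegral_mono_on (integrableOn_const hfin) ?_ hmeasΛ fun x hx => ?_
        · refine Measure.integrableOn_of_bounded
            (M := volume.real (ball (0 : EuclideanSpace ℝ (Fin n)) 1) ^ q) hfin ?_ ?_
          · have h := (stronglyMeasurable_extOp
              ((measurable_const (a := (1 : ℂ))).indicator hmeas)).norm.measurable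
            exact (h.pow_const q).aestronglyMeasurable
          · filter_upwards with x
            rw [Real.norm_of_nonneg (by positivity)]
            exact Real.rpow_le_rpow (norm_nonneg _) (norm_extOp_le hind x) hq
        · exact Real.rpow_le_rpow (by positivity) (half_volume_le_norm_extOp hk hk1 hR hx) hq

lemma volume_abs_lt (r : ℝ) : volume {t : ℝ | |t| < r} = ENNReal.ofReal (2 * r) := by
  rw [← Real.volume_ball 0 r]
  congr 1
  ext t
  simp

lemma le_volume_Omega {n k : ℕ} {κ R : ℝ} (hk : k ≤ n + 1) (hk1 : 1 ≤ k) (hR : 1 ≤ R)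
    (hκ : κ ≤ 1 / 6) (hR0 : 2 * Real.pi * (n + 2) ≤ R ^ κ) :
    (1 / (1000 * (n + 1) ^ 2 * (2 * Real.pi))) ^ n *
        R ^ (((n : ℝ) + 1 - k) * (-1 / 2) + (k - 1) * (κ - 1))
      ≤ volume.real (Omega n k κ R) := by
  have hRpos : 0 < R := by linarith
  have hπ := Real.pi_gt_three
  have hn : (0 : ℝ) ≤ n := n.cast_nonneg
  set C : ℝ := 1 / (1000 * (n + 1) ^ 2 * (2 * Real.pi)) with hC
  have hC0 : 0 < C := by positivity
  have hfin : volume (Omega n k κ R) ≠ ⊤ :=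
    measure_ne_top_of_subset Set.inter_subset_right measure_ball_lt_top.ne
  rw [Measure.real, ← ENNReal.ofReal_le_iff_le_toReal hfin]
  set m := n + 1 - k with hm
  have hmn : m ≤ n := by omega
  have hmc : (m : ℝ) = n + 1 - k := by rw [hm, Nat.cast_sub hk]; push_cast; ring
  set e : Fin n → ℝ := fun i => if (i : ℕ) < m then -1 / 2 else κ - 1 with he
  have hprod : C ^ n * R ^ (((n : ℝ) + 1 - k) * (-1 / 2) + (k - 1) * (κ - 1)) =
      ∏ i, C * R ^ e i := by
    rw [Finset.prod_mul_distrib, ← Real.rpow_sum_of_pos hRpos, sum_ite_val_lt hmn, hmc]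
    simp only [Finset.prod_const, Finset.card_univ, Fintype.card_fin]
    congr 2
    ring
  rw [hprod]
  set r : ℝ := 1 / 1000 * R⁻¹ / (n + 1) with hr
  have hκ1 : R ^ (-κ) = (R ^ κ)⁻¹ := Real.rpow_neg hRpos.le _
  have hκ2 : R ^ (κ - 1) = R ^ κ * R⁻¹ := by rw [Real.rpow_sub_one hRpos.ne']; rfl
  have hκR : R ^ κ ≤ R := by
    simpa using Real.rpow_le_rpow_of_exponent_le hR (show κ ≤ 1 by linarith)
  have hneg : R ^ (-(1 : ℝ) / 2) ≤ 1 := Real.rpow_le_one_of_one_le_of_nonpos hR (by norm_num)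
  have hneg0 : 0 < R ^ (-(1 : ℝ) / 2) := Real.rpow_pos_of_pos hRpos _
  generalize R ^ κ = X at *
  have hX0 : 0 < X := by nlinarith
  have hRi1 : R⁻¹ ≤ X⁻¹ := inv_anti₀ hX0 hκR
  refine ofReal_prod_le_volume
    (fun i => if (i : ℕ) < m then {t : ℝ | |t| < 1 / 1000 * R ^ (-(1 : ℝ) / 2) / (n + 1)}
      else {t : ℝ | |t| < 1 / (n + 1) ∧ ∃ b : ℤ, |t - 2 * Real.pi * X⁻¹ * b| < r})
    _ (fun i => by positivity) (fun i => ?_) fun ξ hξ => ?_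
  · simp only [he]
    split_ifs with hi
    · rw [volume_abs_lt]
      refine ENNReal.ofReal_le_ofReal ?_
      have : C ≤ 2 * (1 / 1000 / (n + 1)) := by
        rw [hC, div_le_iff₀ (by positivity)]
        have : (2 : ℝ) * (1 / 1000 / (n + 1)) * (1000 * (n + 1) ^ 2 * (2 * Real.pi)) =
          4 * (n + 1) * Real.pi := by field_simp; norm_num
        rw [this]
        nlinarith
      calc C * R ^ (-(1 : ℝ) / 2) ≤ 2 * (1 / 1000 / (n + 1)) * R ^ (-(1 : ℝ) / 2) := by gcongr
        _ = _ := by ring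
    · refine le_trans (ENNReal.ofReal_le_ofReal ?_)
        (ofReal_le_volume_lattice_nhds (by positivity) ?_ ?_)
      · rw [hκ2, hC, hr]
        refine le_of_eq ?_
        field_simp
      · have : r ≤ R⁻¹ := by
          rw [hr, div_le_iff₀ (by positivity)]
          have := inv_pos.2 hRpos
          nlinarith
        have := inv_pos.2 hX0
        nlinarith
      · rw [← div_eq_mul_inv, div_le_div_iff₀ hX0 (by positivity)]
        nlinarith
  · have h1 : ∀ i : Fin n, (i : ℕ) < m → |ξ i| < 1 / 1000 * R ^ (-(1 : ℝ) / 2) / (n + 1) := by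
      intro i hi
      simpa [hi] using hξ i
    have h2 : ∀ i : Fin n, ∃ b : ℤ, ((i : ℕ) < m → b = 0) ∧ (m ≤ (i : ℕ) → |ξ i| < 1 / (n + 1) ∧
        |ξ i - 2 * Real.pi * X⁻¹ * b| < r) := by
      intro i
      by_cases hi : (i : ℕ) < m
      · exact ⟨0, fun _ => rfl, fun h => absurd hi (not_lt.2 h)⟩
      · have h := hξ i
        simp only [hi, if_false] at h
        obtain ⟨h, b, hb⟩ := h
        exact ⟨b, fun h => absurd h hi, fun _ => ⟨h, hb⟩⟩
    choose b hb0 hb using h2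
    refine ⟨⟨?_, b, hb0, ?_⟩, ?_⟩
    · exact sum_ite_sq_lt _ (fun i => ξ i) (by positivity) fun i hi => (h1 i hi).le
    · rw [hκ1]
      exact sum_ite_sq_lt _ (fun i => ξ i - 2 * Real.pi * X⁻¹ * b i) (by positivity)
        fun i hi => (hb i hi).2.le
    · rw [mem_ball_zero_iff, ← sq_lt_sq₀ (norm_nonneg _) zero_le_one,
        EuclideanSpace.real_norm_sq_eq]
      have := sum_ite_sq_lt (fun _ => True) (fun i => ξ i) one_pos fun i _ => ?_
      · simpa using this
      · by_cases hi : (i : ℕ) < m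
        · refine (h1 i hi).le.trans ?_
          gcongr
          nlinarith
        · exact (hb i (not_lt.1 hi)).1.le

lemma le_volume_Lambda {n k : ℕ} {κ R : ℝ} (hk : k ≤ n + 1) (hk1 : 1 ≤ k) (hR : 1 ≤ R)
    (hκ : κ ≤ 1 / 6) (hR0 : 2 * Real.pi * (n + 2) ≤ R ^ κ) :
    (1 / (1000 * (n + 2) ^ 2)) ^ (n + 1) *
        R ^ (((n : ℝ) + 1 - k) * (1 / 2) + (k - 1) * (1 - κ) + (1 - 2 * κ))
      ≤ volume.real (Lambda n k κ R) := by
  have hRpos : 0 < R := by linarith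
  have hπ := Real.pi_gt_three
  have hn : (0 : ℝ) ≤ n := n.cast_nonneg
  set C : ℝ := 1 / (1000 * (n + 2) ^ 2) with hC
  have hC0 : 0 < C := by positivity
  have hfin : volume (Lambda n k κ R) ≠ ⊤ :=
    measure_ne_top_of_subset Set.inter_subset_right measure_ball_lt_top.ne
  rw [Measure.real, ← ENNReal.ofReal_le_iff_le_toReal hfin]
  set m := n + 1 - k with hm
  have hmn : m ≤ n := by omega
  have hmc : (m : ℝ) = n + 1 - k := by rw [hm, Nat.cast_sub hk]; push_cast; ring
  set e : Fin (n + 1) → ℝ := fun i =>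
    if (i : ℕ) < m then 1 / 2 else if (i : ℕ) < n then 1 - κ else 1 - 2 * κ with he
  have hprod : C ^ (n + 1) *
      R ^ (((n : ℝ) + 1 - k) * (1 / 2) + (k - 1) * (1 - κ) + (1 - 2 * κ)) =
      ∏ i, C * R ^ e i := by
    have hsum : ∑ i, e i = m * (1 / 2) + ((n : ℝ) - m) * (1 - κ) + (1 - 2 * κ) := by
      rw [Fin.sum_univ_castSucc, ← sum_ite_val_lt hmn]
      simp [he, not_lt.2 hmn]
    rw [Finset.prod_mul_distrib, ← Real.rpow_sum_of_pos hRpos, hsum, hmc]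
    simp only [Finset.prod_const, Finset.card_univ, Fintype.card_fin]
    congr 2
    ring
  rw [hprod]
  set r : ℝ := 1 / 1000 / (n + 2) with hr
  have hκ1 : R ^ (1 - κ) = R / R ^ κ := by rw [Real.rpow_sub hRpos, Real.rpow_one]
  have hκ2 : R ^ (1 - 2 * κ) = R / (R ^ κ) ^ 2 := by
    rw [Real.rpow_sub hRpos, Real.rpow_one, mul_comm, Real.rpow_mul hRpos.le]
    norm_num
  have hκ3 : R ^ (2 * κ) = (R ^ κ) ^ 2 := by
    rw [mul_comm, Real.rpow_mul hRpos.le]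
    norm_num
  have hκR : (R ^ κ) ^ 3 ≤ R := by
    have := Real.rpow_le_rpow_of_exponent_le hR (show κ * (3 : ℕ) ≤ 1 by push_cast; linarith)
    rwa [Real.rpow_one, Real.rpow_mul hRpos.le, Real.rpow_natCast] at this
  have hhalf : R ^ ((1 : ℝ) / 2) ≤ R := by
    simpa using Real.rpow_le_rpow_of_exponent_le hR (show (1 : ℝ) / 2 ≤ 1 by norm_num)
  have hhalf0 : 0 < R ^ ((1 : ℝ) / 2) := Real.rpow_pos_of_pos hRpos _
  generalize hX : R ^ κ = X at *
  have hX2 : (n : ℝ) + 2 ≤ X := by nlinarith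
  have hX0 : 0 < X := by linarith
  have hX1 : 1 ≤ X := by linarith
  have hXR : X ^ 2 * (n + 2) ≤ R := by nlinarith [sq_nonneg X]
  have hXR1 : X * (n + 2) ≤ R := by nlinarith [mul_le_mul_of_nonneg_right hX1 hX0.le]
  have hr1 : r ≤ 1 / 1000 := by
    rw [hr]
    exact div_le_self (by norm_num) (by linarith)
  have hr0 : 0 < r := by positivity
  refine ofReal_prod_le_volume
    (fun i => if (i : ℕ) < m then {t : ℝ | |t| < 1 / 1000 * R ^ ((1 : ℝ) / 2) / (n + 2)}
      else if (i : ℕ) < n then {t : ℝ | |t| < R / (n + 2) ∧ ∃ b : ℤ, |t - X * b| < r}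
      else {t : ℝ | |t| < R / (n + 2) ∧ ∃ b : ℤ, |t - 1 / (2 * Real.pi) * X ^ 2 * b| < r})
    _ (fun i => by positivity) (fun i => ?_) fun x hx => ?_
  · simp only [he]
    split_ifs with hi hi'
    · rw [volume_abs_lt]
      refine ENNReal.ofReal_le_ofReal ?_
      have : C ≤ 2 * (1 / 1000 / (n + 2)) := by
        rw [hC, div_le_iff₀ (by positivity)]
        have : (2 : ℝ) * (1 / 1000 / (n + 2)) * (1000 * (n + 2) ^ 2) = 2 * (n + 2) := by
          field_simp
        rw [this]
        linarith
      calc C * R ^ ((1 : ℝ) / 2) ≤ 2 * (1 / 1000 / (n + 2)) * R ^ ((1 : ℝ) / 2) := by gcongr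
        _ = _ := by ring
    · refine le_trans (ENNReal.ofReal_le_ofReal ?_)
        (ofReal_le_volume_lattice_nhds hr0 (by linarith) ?_)
      · rw [hκ1, hC, hr]
        refine le_of_eq ?_
        field_simp
      · rwa [le_div_iff₀ (by positivity)]
    · have hπX : 1 / (2 * Real.pi) * X ^ 2 ≤ X ^ 2 :=
        mul_le_of_le_one_left (by positivity) (by rw [div_le_one (by positivity)]; linarith)
      refine le_trans (ENNReal.ofReal_le_ofReal ?_)
        (ofReal_le_volume_lattice_nhds hr0 ?_ ?_)
      · calc C * R ^ (1 - 2 * κ) = R / (n + 2) * r / X ^ 2 := by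
              rw [hκ2, hC, hr]
              field_simp
          _ ≤ _ := div_le_div_of_nonneg_left (by positivity) (by positivity) hπX
      · have : X ≤ 1 / (2 * Real.pi) * X ^ 2 := by
          rw [one_div_mul_eq_div, le_div_iff₀ (by positivity)]
          nlinarith
        linarith
      · rw [le_div_iff₀ (by positivity)]
        nlinarith
  · have hd : ((n + 1 : ℕ) : ℝ) + 1 = n + 2 := by push_cast; ring
    have h1 : ∀ i : Fin (n + 1), (i : ℕ) < m →
        |x i| < 1 / 1000 * R ^ ((1 : ℝ) / 2) / (n + 2) := by
      intro i hi
      simpa [hi] using hx i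
    have h2 : ∀ i : Fin (n + 1), ∃ b : ℤ, (¬(m ≤ (i : ℕ) ∧ (i : ℕ) < n) → b = 0) ∧
        (m ≤ (i : ℕ) ∧ (i : ℕ) < n → |x i| < R / (n + 2) ∧ |x i - X * b| < r) := by
      intro i
      by_cases hi : m ≤ (i : ℕ) ∧ (i : ℕ) < n
      · have h := hx i
        simp only [not_lt.2 hi.1, hi.2, if_false, if_true] at h
        obtain ⟨h, b, hb⟩ := h
        exact ⟨b, fun h => absurd hi h, fun _ => ⟨h, hb⟩⟩
      · exact ⟨0, fun _ => rfl, fun h => absurd h hi⟩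
    choose a ha0 ha using h2
    have h3 := hx (Fin.last n)
    simp only [Fin.val_last, not_lt.2 hmn, lt_irrefl, if_false] at h3
    obtain ⟨h3, j, hj⟩ := h3
    refine ⟨⟨?_, ⟨a, ha0, ?_⟩, j, ?_⟩, ?_⟩
    · exact sum_ite_sq_lt _ (fun i => x i) (by positivity) fun i hi => by
        rw [hd]; exact (h1 i hi).le
    · rw [hX]
      exact sum_ite_sq_lt _ (fun i => x i - X * a i) (ρ := 1 / 1000) (by norm_num)
        fun i hi => by rw [hd]; exact (ha i hi).2.le
    · rw [hκ3]
      exact hj.trans_le hr1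
    · rw [mem_ball_zero_iff, ← sq_lt_sq₀ (norm_nonneg _) hRpos.le,
        EuclideanSpace.real_norm_sq_eq]
      have := sum_ite_sq_lt (fun _ => True) (fun i => x i) hRpos fun i _ => ?_
      · simpa using this
      · rw [hd]
        by_cases hi : (i : ℕ) < m
        · refine (h1 i hi).le.trans ?_
          gcongr
          linarith
        · by_cases hi' : (i : ℕ) < n
          · exact (ha i ⟨not_lt.1 hi, hi'⟩).1.le
          · have : i = Fin.last n := Fin.ext (by simp; omega)
            rw [this]
            exact h3.le

/-- With `κ = 1/(2(k+1))`, `g = 1_Ω` and `H = 1_Λ`, for every `1 ≤ q < ∞` there are `c₀ > 0`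
and `R₀ ≥ 1` such that for all `R ≥ R₀`,
`‖Eg‖_{L^q(B^{n+1}(0,R), H dx)} ≥ c₀ · R^{((n+k)/2)(1/q - 1/2) + k/(2(k+1))} · ‖g‖₂`. -/
theorem stmt8 (n k : ℕ) (hn : 1 ≤ n) (hk2 : 2 ≤ k) (hk : k ≤ n + 1)
    (q : ℝ) (hq : 1 ≤ q) :
    ∃ c₀ R₀ : ℝ, 0 < c₀ ∧ 1 ≤ R₀ ∧
      ∀ R : ℝ, R₀ ≤ R →
        c₀ * R ^ (((n : ℝ) + k) / 2 * (1 / q - 1 / 2) + (k : ℝ) / (2 * ((k : ℝ) + 1))) *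
            (∫ ξ, ‖(Omega n k (1 / (2 * ((k : ℝ) + 1))) R).indicator
                (fun _ => (1 : ℂ)) ξ‖ ^ 2) ^ ((1 : ℝ) / 2)
          ≤ (∫ x in ball (0 : EuclideanSpace ℝ (Fin (n + 1))) R,
              ‖extOp n ((Omega n k (1 / (2 * ((k : ℝ) + 1))) R).indicator
                  (fun _ => (1 : ℂ))) x‖ ^ q *
                (Lambda n k (1 / (2 * ((k : ℝ) + 1))) R).indicator (fun _ => (1 : ℝ)) x)
              ^ (1 / q) := by
  have hk0 : (2 : ℝ) ≤ k := by exact_mod_cast hk2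
  have hn0 : (0 : ℝ) ≤ n := n.cast_nonneg
  have hπ := Real.pi_gt_three
  have hq0 : 0 < q := by linarith
  set κ : ℝ := 1 / (2 * ((k : ℝ) + 1)) with hκ
  have hκ0 : 0 < κ := by positivity
  have hκ6 : κ ≤ 1 / 6 := by
    rw [hκ]
    exact one_div_le_one_div_of_le (by norm_num) (by linarith)
  have hκk : 2 * (k + 1) * κ = 1 := by rw [hκ]; field_simp
  set M : ℝ := 2 * Real.pi * (n + 2) with hM
  have hM1 : 1 ≤ M := by nlinarith
  set C₁ : ℝ := (1 / (1000 * (n + 1) ^ 2 * (2 * Real.pi))) ^ n with hC₁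
  set C₂ : ℝ := (1 / (1000 * (n + 2) ^ 2)) ^ (n + 1) with hC₂
  have hC₁0 : 0 < C₁ := by positivity
  have hC₂0 : 0 < C₂ := by positivity
  refine ⟨1 / 2 * C₁ ^ (1 / 2 : ℝ) * C₂ ^ (1 / q), M ^ κ⁻¹, by positivity,
    Real.one_le_rpow hM1 (by positivity), fun R hR => ?_⟩
  have hR1 : 1 ≤ R := (Real.one_le_rpow hM1 (by positivity)).trans hR
  have hRpos : 0 < R := by linarith
  have hMR : M ≤ R ^ κ := by
    have := Real.rpow_le_rpow (by positivity) hR hκ0.le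
    rwa [← Real.rpow_mul (by positivity), inv_mul_cancel₀ hκ0.ne', Real.rpow_one] at this
  have hV := le_volume_Omega hk (by omega) hR1 hκ6 hMR
  have hW := le_volume_Lambda hk (by omega) hR1 hκ6 hMR
  have hI := half_volume_rpow_mul_le_integral (n := n) (k := k) (κ := κ) hk (by omega) hR1 hq0.le
  rw [← hC₁] at hV
  rw [← hC₂] at hW
  have hL2 : ∫ ξ, ‖(Omega n k κ R).indicator (fun _ => (1 : ℂ)) ξ‖ ^ 2 =
      volume.real (Omega n k κ R) := by
    rw [← integral_indicator_one (isOpen_Omega n k κ R).measurableSet]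
    congr 1
    ext ξ
    by_cases h : ξ ∈ Omega n k κ R <;> simp [h]
  rw [hL2]
  refine le_trans ?_ (Real.rpow_le_rpow (by positivity) hI (by positivity))
  set V := volume.real (Omega n k κ R)
  set W := volume.real (Lambda n k κ R)
  have hV0 : 0 ≤ V := measureReal_nonneg
  have hW0 : 0 ≤ W := measureReal_nonneg
  have hVV : V ^ (1 / 2 : ℝ) * V ^ (1 / 2 : ℝ) = V := by
    rw [← Real.sqrt_eq_rpow, Real.mul_self_sqrt hV0]
  have hV' := Real.rpow_le_rpow (by positivity) hV (show (0 : ℝ) ≤ 1 / 2 by norm_num)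
  have hW' := Real.rpow_le_rpow (by positivity) hW (show (0 : ℝ) ≤ 1 / q by positivity)
  rw [Real.mul_rpow (by positivity) (by positivity), ← Real.rpow_mul hRpos.le] at hV' hW'
  rw [Real.mul_rpow (by positivity) hW0, ← Real.rpow_mul (by positivity), mul_one_div_cancel hq0.ne',
    Real.rpow_one]
  have hexp : ((n : ℝ) + k) / 2 * (1 / q - 1 / 2) + (k : ℝ) / (2 * ((k : ℝ) + 1)) =
      (((n : ℝ) + 1 - k) * (-1 / 2) + (k - 1) * (κ - 1)) * (1 / 2) +
      (((n : ℝ) + 1 - k) * (1 / 2) + (k - 1) * (1 - κ) + (1 - 2 * κ)) * (1 / q) := by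
    have : (k : ℝ) / (2 * ((k : ℝ) + 1)) = k * κ := by rw [hκ]; ring
    rw [this]
    linear_combination (1 / 4 + 1 / q * (1 / 2)) * hκk
  rw [hexp, Real.rpow_add hRpos]
  calc _ = 1 / 2 * V ^ (1 / 2 : ℝ) *
        ((C₁ ^ (1 / 2 : ℝ) * R ^ ((((n : ℝ) + 1 - k) * (-1 / 2) + (k - 1) * (κ - 1)) * (1 / 2))) *
        (C₂ ^ (1 / q) *
          R ^ ((((n : ℝ) + 1 - k) * (1 / 2) + (k - 1) * (1 - κ) + (1 - 2 * κ)) * (1 / q)))) := by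
        ring
    _ ≤ 1 / 2 * V ^ (1 / 2 : ℝ) * (V ^ (1 / 2 : ℝ) * W ^ (1 / q)) := by gcongr
    _ = V / 2 * W ^ (1 / q) := by linear_combination (1 / 2 * W ^ (1 / q)) * hVV
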